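/- Let ν be a Borel probability measure on the torus 𝕋 whose Fourier coefficients do not tend to 0, i.e. limsup_{p→∞} |ν̂(p)| > 0. Then there is a Borel set A ⊆ ℝ whose complement has Lebesgue measure zero such that for every α ∈ A there is no good set S with μ_{S,α} = ν. -/

import Mathlib

open MeasureTheory Filter Topology
open scoped BigOperators

noncomputable section

open Classical in
/-- `S(N) = S ∩ {1,…,N}` as a `Finset`. -/
def initSeg (S : Set ℕ) (N : ℕ) : Finset ℕ := (Finset.Icc 1 N).filter (· ∈ S)

/-- The average `(1/#S(N)) ∑_{s ∈ S(N)} f (sα mod 1)`. -/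
def empAvg (S : Set ℕ) (α : ℝ) (N : ℕ) (f : UnitAddCircle → ℝ) : ℝ :=
  ((initSeg S N).card : ℝ)⁻¹ * ∑ s ∈ initSeg S N, f (((s : ℝ) * α : ℝ) : UnitAddCircle)

/-- `μ` is the weak limit of the empirical measures `(1/#S(N)) ∑_{s ∈ S(N)} δ_{sα mod 1}`. -/
def IsLimitMeasure (S : Set ℕ) (α : ℝ) (μ : Measure UnitAddCircle) : Prop :=
  ∀ f : C(UnitAddCircle, ℝ),
    Tendsto (fun N => empAvg S α N (fun x => f x)) atTop (𝓝 (∫ x, f x ∂μ))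

/-- A good set: infinite, and for every `α` the empirical measures converge weakly
to some (probability) limit measure `μ_{S,α}`. -/
def IsGoodSet (S : Set ℕ) : Prop :=
  S.Infinite ∧ ∀ α : ℝ, ∃ μ : Measure UnitAddCircle, IsProbabilityMeasure μ ∧ IsLimitMeasure S α μ

/-- `R` is sublacunary: `log N / #R(N) → 0`. -/
def Sublacunary (R : Set ℕ) : Prop :=
  Tendsto (fun N : ℕ => Real.log N / ((initSeg R N).card : ℝ)) atTop (𝓝 0)

open Classical in
/-- `#{n < N : r_n ∈ S}` where `(r_n)` is the increasing (0-indexed) enumeration of `R`. -/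
def relCount (R S : Set ℕ) (N : ℕ) : ℕ :=
  ((Finset.range N).filter (fun n => Nat.nth (· ∈ R) n ∈ S)).card

/-- Weighted average `(1/∑_{n<N} w n) ∑_{n<N} w n · f (r_n β mod 1)`. -/
def wAvg (R : Set ℕ) (w : ℕ → ℝ) (β : ℝ) (N : ℕ) (f : UnitAddCircle → ℝ) : ℝ :=
  (∑ n ∈ Finset.range N, w n)⁻¹ *
    ∑ n ∈ Finset.range N, w n * f (((Nat.nth (· ∈ R) n : ℝ) * β : ℝ) : UnitAddCircle)

/-- `μ` is the weak limit of the `w`-weighted empirical measures along `R` at `β`. -/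
def IsWeightLimit (R : Set ℕ) (w : ℕ → ℝ) (β : ℝ) (μ : Measure UnitAddCircle) : Prop :=
  ∀ f : C(UnitAddCircle, ℝ),
    Tendsto (fun N => wAvg R w β N (fun x => f x)) atTop (𝓝 (∫ x, f x ∂μ))

/-- A good weight on `R` (indexed by the increasing enumeration of `R`). -/
def IsGoodWeight (R : Set ℕ) (w : ℕ → ℝ) : Prop :=
  (∀ n, 0 ≤ w n) ∧ ¬ Summable w ∧
    ∀ β : ℝ, ∃ μ : Measure UnitAddCircle, IsProbabilityMeasure μ ∧ IsWeightLimit R w β μ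

/-- Besicovitch-type seminorm `‖f‖₁ = limsup_N (1/N) ∑_{n<N} |f n|`. -/
def besic (f : ℕ → ℝ) : ℝ := Filter.limsup (fun N => (∑ n ∈ Finset.range N, |f n|) / N) atTop

/-- An integrable weight: approximable in `‖·‖₁` by bounded good weights. -/
def IntegrableWeight (R : Set ℕ) (w : ℕ → ℝ) : Prop :=
  ∀ ε > 0, ∃ v : ℕ → ℝ, IsGoodWeight R v ∧ (∃ C, ∀ n, v n ≤ C) ∧
    besic (fun n => v n - w n) < ε

/-- Total variation distance between two finite Borel measures on the torus. -/
def varDist (μ ν : Measure UnitAddCircle) : ℝ :=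
  ⨆ B : Set UnitAddCircle, ⨆ _ : MeasurableSet B, |(μ B).toReal - (ν B).toReal|

/-- `e(θ) = exp(2πiθ)`. -/
def eC (θ : ℝ) : ℂ := Complex.exp (2 * Real.pi * Complex.I * θ)

/-- `w(R(N)) = ∑_{r ∈ R(N)} w r`. -/
def wSum (R : Set ℕ) (w : ℕ → ℝ) (N : ℕ) : ℝ := ∑ r ∈ initSeg R N, w r

/-- `μ` is the weak limit of `(1/w(R(N))) ∑_{r ∈ R(N)} w r · δ_{rβ mod 1}`. -/
def IsWeightLimitR (R : Set ℕ) (w : ℕ → ℝ) (β : ℝ) (μ : Measure UnitAddCircle) : Prop :=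
  ∀ f : C(UnitAddCircle, ℝ),
    Tendsto
      (fun N => (wSum R w N)⁻¹ * ∑ r ∈ initSeg R N, w r * f (((r : ℝ) * β : ℝ) : UnitAddCircle))
      atTop (𝓝 (∫ x, f x ∂μ))

/-- `f : ℕ → ℂ` has mean `c`. -/
def HasMean (f : ℕ → ℂ) (c : ℂ) : Prop :=
  Tendsto (fun N => (∑ n ∈ Finset.range N, f n) / (N : ℂ)) atTop (𝓝 c)

/-- The seminorm `‖f‖_M = limsup_N |(1/N) ∑_{n<N} f n|`. -/
def meanSeminorm (f : ℕ → ℂ) : ℝ :=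
  Filter.limsup (fun N => ‖(∑ n ∈ Finset.range N, f n) / (N : ℂ)‖) atTop

end

/-- The empirical average of a complex-valued function along `S` at `α`. -/
noncomputable def complexEmpAvg (S : Set ℕ) (N : ℕ) (α : UnitAddCircle) (g : UnitAddCircle → ℂ) : ℂ :=
  ((initSeg S N).card : ℂ)⁻¹ * ∑ s ∈ initSeg S N, g (s • α)

theorem IsLimitMeasure.tendsto_complexEmpAvg {S : Set ℕ} {α : ℝ} {μ : Measure UnitAddCircle}
    [IsProbabilityMeasure μ] (h : IsLimitMeasure S α μ) (g : C(UnitAddCircle, ℂ)) :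
    Tendsto (fun N => complexEmpAvg S N (α : UnitAddCircle) g) atTop (𝓝 (∫ x, g x ∂μ)) := by
  have hg : Integrable (fun x => g x) μ :=
    g.continuous.integrable_of_hasCompactSupport (HasCompactSupport.of_compactSpace _)
  have hre := h ⟨fun x => (g x).re, by fun_prop⟩
  have him := h ⟨fun x => (g x).im, by fun_prop⟩
  have key := ((Complex.continuous_ofReal.tendsto _).comp hre).add
    (((Complex.continuous_ofReal.tendsto _).comp him).mul_const Complex.I)
  have hint : ((∫ x, (g x).re ∂μ : ℝ) : ℂ) + ((∫ x, (g x).im ∂μ : ℝ) : ℂ) * Complex.I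
      = ∫ x, g x ∂μ := integral_re_add_im hg
  simp only [ContinuousMap.coe_mk] at key
  rw [hint] at key
  refine key.congr fun N => ?_
  have hs : ∀ s : ℕ, (((s : ℝ) * α : ℝ) : UnitAddCircle) = s • (α : UnitAddCircle) := fun s => by
    rw [← nsmul_eq_mul, AddCircle.coe_nsmul]
  simp only [complexEmpAvg, empAvg, Function.comp, hs]
  push_cast
  rw [mul_assoc, ← mul_add, Finset.sum_mul, ← Finset.sum_add_distrib]
  simp only [Complex.re_add_im]

theorem complexEmpAvg_fourier_nsmul (S : Set ℕ) (N p : ℕ) (x : UnitAddCircle) :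
    complexEmpAvg S N (p • x) (fourier 1) = complexEmpAvg S N x (fourier (p : ℤ)) := by
  simp only [complexEmpAvg, fourier_apply, one_zsmul, natCast_zsmul]
  congr 1
  refine Finset.sum_congr rfl fun s _ => ?_
  rw [smul_comm]

theorem continuous_complexEmpAvg (S : Set ℕ) (N : ℕ) :
    Continuous fun x : UnitAddCircle => complexEmpAvg S N x (fourier 1) := by
  unfold complexEmpAvg
  fun_prop

theorem integrable_haarAddCircle (f : C(UnitAddCircle, ℂ)) :
    Integrable (fun x => f x) AddCircle.haarAddCircle :=
  f.continuous.integrable_of_hasCompactSupport (HasCompactSupport.of_compactSpace _)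

theorem integral_fourier (k : ℤ) :
    ∫ x : UnitAddCircle, fourier k x ∂AddCircle.haarAddCircle = if k = 0 then 1 else 0 := by
  have := orthonormal_iff_ite.1 (orthonormal_fourier (T := 1)) 0 k
  rw [ContinuousMap.inner_toLp] at this
  simpa [eq_comm] using this

theorem integral_norm_sq_sum_fourier (T : Finset ℕ) :
    ∫ x : UnitAddCircle, ‖∑ s ∈ T, fourier (s : ℤ) x‖ ^ 2 ∂AddCircle.haarAddCircle = T.card := by
  have hpt : ∀ x : UnitAddCircle, ((‖∑ s ∈ T, fourier (s : ℤ) x‖ ^ 2 : ℝ) : ℂ) =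
      ∑ s ∈ T, ∑ t ∈ T, fourier (-(s : ℤ) + t) x := fun x => by
    push_cast
    rw [← Complex.conj_mul', map_sum, Finset.sum_mul_sum]
    simp only [← fourier_neg, ← fourier_add]
  have hcalc : ∫ x : UnitAddCircle, (∑ s ∈ T, ∑ t ∈ T, fourier (-(s : ℤ) + t) x : ℂ)
      ∂AddCircle.haarAddCircle = T.card := by
    rw [integral_finsetSum _ fun (s : ℕ) _ => integrable_finsetSum _ fun (t : ℕ) _ =>
      integrable_haarAddCircle (fourier (-(s : ℤ) + t))]
    calc _ = ∑ s ∈ T, ∑ t ∈ T, if s = t then (1 : ℂ) else 0 := by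
          refine Finset.sum_congr rfl fun s _ => ?_
          rw [integral_finsetSum _ fun (t : ℕ) _ => integrable_haarAddCircle
            (fourier (-(s : ℤ) + t))]
          refine Finset.sum_congr rfl fun t _ => ?_
          rw [integral_fourier]
          congr 1
          exact propext (by lia)
      _ = T.card := by simp
  rw [← Complex.ofReal_inj, ← integral_complex_ofReal, Complex.ofReal_natCast, ← hcalc]
  exact integral_congr_ae (ae_of_all _ hpt)

theorem integral_norm_sq_complexEmpAvg (S : Set ℕ) (N : ℕ) :
    ∫ x, ‖complexEmpAvg S N x (fourier 1)‖ ^ 2 ∂AddCircle.haarAddCircle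
      = ((initSeg S N).card : ℝ)⁻¹ := by
  have h : ∀ x : UnitAddCircle, ‖complexEmpAvg S N x (fourier 1)‖ ^ 2 =
      (((initSeg S N).card : ℝ)⁻¹) ^ 2 * ‖∑ s ∈ initSeg S N, fourier (s : ℤ) x‖ ^ 2 := fun x => by
    simp [complexEmpAvg, fourier_apply, mul_pow]
  simp only [h]
  rw [integral_const_mul, integral_norm_sq_sum_fourier]
  rcases eq_or_ne ((initSeg S N).card : ℝ) 0 with h0 | h0
  · simp [h0]
  · field_simp

theorem tendsto_card_initSeg {S : Set ℕ} (hS : S.Infinite) :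
    Tendsto (fun N => (initSeg S N).card) atTop atTop := by
  classical
  refine tendsto_atTop_atTop_of_monotone (fun a b hab => Finset.card_le_card ?_) fun b => ?_
  · exact Finset.filter_subset_filter _ (Finset.Icc_subset_Icc_right hab)
  · obtain ⟨t, htS, htb⟩ := (hS.sdiff (Set.finite_singleton 0)).exists_subset_card_eq b
    refine ⟨t.sup id, htb ▸ Finset.card_le_card fun s hs => ?_⟩
    have := htS hs
    simp only [initSeg, Finset.mem_filter, Finset.mem_Icc]
    exact ⟨⟨Nat.one_le_iff_ne_zero.2 this.2, Finset.le_sup (f := id) hs⟩, this.1⟩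

/-- The averages of exponentials along a good set cannot stay eventually above a fixed `δ > 0`
at every point of a dense set. -/
theorem IsGoodSet.not_forall_dense_lt {S : Set ℕ} (hS : IsGoodSet S) {D : Set UnitAddCircle}
    (hD : Dense D) {δ : ℝ} (hδ : 0 < δ)
    (h : ∀ x ∈ D, ∀ᶠ N in atTop, δ < ‖complexEmpAvg S N x (fourier 1)‖) : False := by
  set F : ℕ → UnitAddCircle → ℂ := fun N x => complexEmpAvg S N x (fourier 1) with hF
  have hcont : ∀ N, Continuous (F N) := continuous_complexEmpAvg S
  have hcauchy : ∀ x, CauchySeq fun N => F N x := fun x => by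
    obtain ⟨a, rfl⟩ := QuotientAddGroup.mk_surjective x
    obtain ⟨μ, hμ, hlim⟩ := hS.2 a
    exact (hlim.tendsto_complexEmpAvg (fourier 1)).cauchySeq
  let K : ℕ → Set UnitAddCircle := fun n => ⋂ m ≥ n, {x | dist (F m x) (F n x) ≤ δ / 4}
  have hKclosed : ∀ n, IsClosed (K n) := fun n => isClosed_biInter fun m _ =>
    isClosed_le ((hcont m).dist (hcont n)) continuous_const
  have hKcover : ⋃ n, K n = Set.univ := by
    refine Set.eq_univ_of_forall fun x => Set.mem_iUnion.2 ?_
    obtain ⟨n, hn⟩ := Metric.cauchySeq_iff'.1 (hcauchy x) (δ / 4) (by positivity)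
    exact ⟨n, Set.mem_iInter₂.2 fun m hm => (hn m hm).le⟩
  obtain ⟨n, hn⟩ := nonempty_interior_of_iUnion_of_closed hKclosed hKcover
  obtain ⟨x, hxU, hxD⟩ := hD.inter_open_nonempty _ isOpen_interior hn
  have hclose : ∀ m ≥ n, ∀ y ∈ interior (K n), dist (F m y) (F n y) ≤ δ / 4 := fun m hm y hy =>
    Set.mem_iInter₂.1 (interior_subset hy) m hm
  let V := interior (K n) ∩ {y | δ / 2 < ‖F n y‖}
  have hVopen : IsOpen V :=
    isOpen_interior.inter (isOpen_lt continuous_const (hcont n).norm)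
  have hVne : V.Nonempty := by
    obtain ⟨m, hmn, hm⟩ := ((h x hxD).and (eventually_ge_atTop n)).exists
    refine ⟨x, hxU, ?_⟩
    have h1 := hclose m hm x hxU
    have h2 := norm_sub_norm_le (F m x) (F n x)
    rw [dist_eq_norm] at h1
    change δ / 2 < ‖F n x‖
    have h3 : δ < ‖F m x‖ := hmn
    linarith
  have hVlow : ∀ m ≥ n, ∀ y ∈ V, (δ / 4) ^ 2 ≤ ‖F m y‖ ^ 2 := fun m hm y hy => by
    have h1 := hclose m hm y hy.1
    have h2 := norm_sub_norm_le (F n y) (F m y)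
    rw [dist_comm, dist_eq_norm] at h1
    have h3 : δ / 2 < ‖F n y‖ := hy.2
    have : δ / 4 ≤ ‖F m y‖ := by linarith
    gcongr
  let μ : Measure UnitAddCircle := AddCircle.haarAddCircle
  have hVpos : 0 < μ.real V := ENNReal.toReal_pos (hVopen.measure_pos μ hVne).ne' (by finiteness)
  have hlow : ∀ m ≥ n, (δ / 4) ^ 2 * μ.real V ≤ ((initSeg S m).card : ℝ)⁻¹ := fun m hm => by
    rw [← integral_norm_sq_complexEmpAvg]
    have hint : Integrable (fun y => ‖F m y‖ ^ 2) μ :=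
      ((hcont m).norm.pow 2).integrable_of_hasCompactSupport (HasCompactSupport.of_compactSpace _)
    refine le_trans ?_ (setIntegral_le_integral (s := V) hint (ae_of_all _ fun y => by positivity))
    have := setIntegral_mono_on (integrableOn_const (by finiteness)) hint.integrableOn
      hVopen.measurableSet (hVlow m hm)
    simpa [mul_comm] using this
  have hlim : Tendsto (fun m => ((initSeg S m).card : ℝ)⁻¹) atTop (𝓝 0) :=
    tendsto_inv_atTop_zero.comp (tendsto_natCast_atTop_atTop.comp (tendsto_card_initSeg hS.1))
  have := ge_of_tendsto hlim ((eventually_ge_atTop n).mono hlow)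
  have : 0 < (δ / 4) ^ 2 * μ.real V := by positivity
  linarith

theorem continuous_nsmul_coe (p : ℕ) : Continuous fun x : ℝ => p • (x : UnitAddCircle) :=
  (continuous_nsmul p).comp (AddCircle.continuous_mk' 1)

theorem integrableOn_comp_nsmul_coe (f : C(UnitAddCircle, ℂ)) (p : ℕ) {E : Set ℝ}
    (hE : volume E ≠ ⊤) : IntegrableOn (fun x : ℝ => f (p • (x : UnitAddCircle))) E := by
  refine Measure.integrableOn_of_bounded (M := ‖f‖) hE ?_ (ae_of_all _ fun x => f.norm_coe_le_norm _)
  have : Continuous fun x : ℝ => f (p • (x : UnitAddCircle)) :=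
    f.continuous.comp (continuous_nsmul_coe p)
  exact this.aestronglyMeasurable

theorem tendsto_setIntegral_fourier_nsmul {E : Set ℝ} (hEm : MeasurableSet E) (k : ℤ) :
    Tendsto (fun p : ℕ => ∫ x in E, (fourier k (p • (x : UnitAddCircle)) : ℂ)) atTop
      (𝓝 (volume.real E * ∫ x : UnitAddCircle, fourier k x ∂AddCircle.haarAddCircle)) := by
  rcases eq_or_ne k 0 with rfl | hk
  · simp
  rw [integral_fourier, if_neg hk, mul_zero]
  have hw : Tendsto (fun p : ℕ => -((k : ℝ) * p)) atTop (cocompact ℝ) := by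
    rw [← Metric.cobounded_eq_cocompact, ← comap_norm_atTop, tendsto_comap_iff]
    have : Tendsto (fun p : ℕ => |(k : ℝ)| * (p : ℝ)) atTop atTop :=
      tendsto_natCast_atTop_atTop.const_mul_atTop (by positivity)
    refine this.congr fun p => ?_
    simp
  refine ((Real.tendsto_integral_exp_smul_cocompact (E.indicator fun _ => (1 : ℂ))).comp hw).congr
    fun p => ?_
  rw [← integral_indicator hEm]
  refine integral_congr_ae (ae_of_all _ fun x => ?_)
  by_cases hx : x ∈ E
  · simp only [Set.indicator_of_mem hx]
    rw [← AddCircle.coe_nsmul, fourier_coe_apply, Circle.smul_def, Real.fourierChar_apply]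
    simp
    ring_nf
  · simp [Set.indicator_of_notMem hx]

/-- Multiplication by `p` on the circle is asymptotically independent of any fixed set of finite
measure as `p → ∞`. -/
theorem tendsto_setIntegral_comp_nsmul {E : Set ℝ} (hEm : MeasurableSet E) (hE : volume E ≠ ⊤)
    (f : C(UnitAddCircle, ℂ)) :
    Tendsto (fun p : ℕ => ∫ x in E, f (p • (x : UnitAddCircle))) atTop
      (𝓝 (volume.real E * ∫ x, f x ∂AddCircle.haarAddCircle)) := by
  have hspan : ∀ g ∈ Submodule.span ℂ (Set.range (@fourier (1 : ℝ))),
      Tendsto (fun p : ℕ => ∫ x in E, g (p • (x : UnitAddCircle))) atTop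
        (𝓝 (volume.real E * ∫ x, g x ∂AddCircle.haarAddCircle)) := by
    intro g hg
    induction hg using Submodule.span_induction with
    | mem g hg =>
      obtain ⟨k, rfl⟩ := hg
      exact tendsto_setIntegral_fourier_nsmul hEm k
    | zero => simp
    | add g₁ g₂ _ _ h₁ h₂ =>
      simp only [ContinuousMap.add_apply]
      rw [integral_add (integrable_haarAddCircle g₁) (integrable_haarAddCircle g₂), mul_add]
      refine (h₁.add h₂).congr fun p => ?_
      rw [integral_add (integrableOn_comp_nsmul_coe g₁ p hE) (integrableOn_comp_nsmul_coe g₂ p hE)]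
    | smul c g _ h =>
      simp only [ContinuousMap.smul_apply, integral_smul]
      rw [mul_smul_comm]
      exact h.const_smul c
  have hf : f ∈ closure (Submodule.span ℂ (Set.range (@fourier (1 : ℝ))) : Set _) := by
    rw [← Submodule.topologicalClosure_coe, span_fourier_closure_eq_top]
    trivial
  rw [Metric.tendsto_atTop]
  intro ε hε
  have hvol : 0 ≤ volume.real E := measureReal_nonneg
  set η := ε / (3 * (volume.real E + 1)) with hη
  have hηpos : 0 < η := by positivity
  obtain ⟨g, hg, hfg⟩ := Metric.mem_closure_iff.1 hf η hηpos
  obtain ⟨n, hn⟩ := Metric.tendsto_atTop.1 (hspan g hg) (ε / 3) (by positivity)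
  have hfg' : ∀ y, ‖f y - g y‖ ≤ η := fun y => by
    rw [← dist_eq_norm]
    exact (ContinuousMap.dist_apply_le_dist y).trans hfg.le
  have hηvol : η * volume.real E ≤ ε / 3 := by
    have : η * (volume.real E + 1) = ε / 3 := by rw [hη]; field_simp
    nlinarith
  refine ⟨n, fun p hp => ?_⟩
  have h1 : dist (∫ x in E, f (p • (x : UnitAddCircle))) (∫ x in E, g (p • (x : UnitAddCircle)))
      ≤ ε / 3 := by
    rw [dist_eq_norm, ← integral_sub (integrableOn_comp_nsmul_coe f p hE)
      (integrableOn_comp_nsmul_coe g p hE)]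
    exact (norm_setIntegral_le_of_norm_le_const hE.lt_top fun x _ => hfg' _).trans hηvol
  have h2 : dist (volume.real E * ∫ x, g x ∂AddCircle.haarAddCircle)
      (volume.real E * ∫ x, f x ∂AddCircle.haarAddCircle) ≤ ε / 3 := by
    rw [dist_comm, dist_eq_norm, ← mul_sub, ← integral_sub (integrable_haarAddCircle f)
      (integrable_haarAddCircle g), norm_mul, Complex.norm_real, Real.norm_of_nonneg hvol]
    have : ‖∫ x, (f x - g x) ∂(AddCircle.haarAddCircle : Measure UnitAddCircle)‖ ≤ η := by
      simpa using norm_integral_le_of_norm_le_const (μ := AddCircle.haarAddCircle)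
        (ae_of_all _ hfg')
    nlinarith
  have h3 := hn p hp
  have h4 := dist_triangle4 (∫ x in E, f (p • (x : UnitAddCircle)))
    (∫ x in E, g (p • (x : UnitAddCircle))) (volume.real E * ∫ x, g x ∂AddCircle.haarAddCircle)
    (volume.real E * ∫ x, f x ∂AddCircle.haarAddCircle)
  linarith

theorem exists_continuousMap_support_subset {V : Set UnitAddCircle} (hV : IsOpen V)
    (hne : V.Nonempty) : ∃ f : C(UnitAddCircle, ℂ), (∀ x ∉ V, f x = 0) ∧
      ∫ x, f x ∂AddCircle.haarAddCircle ≠ 0 := by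
  obtain ⟨v, hv⟩ := hne
  obtain ⟨g, hg0, hg1, hg⟩ := exists_continuous_zero_one_of_isClosed hV.isClosed_compl
    (isClosed_singleton (x := v)) (by simpa using hv)
  refine ⟨⟨fun x => (g x : ℂ), by fun_prop⟩, fun x hx => ?_, ?_⟩
  · simpa using hg0 hx
  · have hpos : 0 < ∫ x, g x ∂AddCircle.haarAddCircle :=
      g.continuous.integral_pos_of_hasCompactSupport_nonneg_nonzero
        (HasCompactSupport.of_compactSpace _) (fun x => (hg x).1) (x := v)
        (by simp [hg1 (Set.mem_singleton v)])
    simp only [ContinuousMap.coe_mk]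
    rw [integral_complex_ofReal]
    exact_mod_cast hpos.ne'

theorem volume_forall_nsmul_notMem {P : Set ℕ} (hP : P.Infinite) {V : Set UnitAddCircle}
    (hV : IsOpen V) (hne : V.Nonempty) :
    volume {x : ℝ | ∀ p ∈ P, p • (x : UnitAddCircle) ∉ V} = 0 := by
  set E : Set ℝ := {x : ℝ | ∀ p ∈ P, p • (x : UnitAddCircle) ∉ V} with hE
  have hEm : MeasurableSet E := by
    refine IsClosed.measurableSet ?_
    simp only [hE, Set.ofPred_forall]
    exact isClosed_biInter fun p _ =>
      hV.isClosed_compl.preimage (continuous_nsmul_coe p)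
  obtain ⟨f, hf, hf0⟩ := exists_continuousMap_support_subset hV hne
  have hball : ∀ n : ℕ, volume (E ∩ Metric.ball 0 n) = 0 := fun n => by
    have hfin : volume (E ∩ Metric.ball 0 n) ≠ ⊤ :=
      measure_ne_top_of_subset Set.inter_subset_right measure_ball_lt_top.ne
    have hlim := tendsto_setIntegral_comp_nsmul (hEm.inter measurableSet_ball) hfin f
    have hfreq : ∃ᶠ p : ℕ in atTop,
        ∫ x in E ∩ Metric.ball 0 n, f (p • (x : UnitAddCircle)) = 0 := by
      refine (Nat.frequently_atTop_iff_infinite.2 hP).mono fun p hp => ?_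
      exact setIntegral_eq_zero_of_forall_eq_zero fun x hx => hf _ (hx.1 p hp)
    have := isClosed_singleton.mem_of_frequently_of_tendsto hfreq hlim
    have h0 : volume.real (E ∩ Metric.ball 0 n) = 0 := by simpa [hf0] using this
    exact (measureReal_eq_zero_iff hfin).1 h0
  refine measure_mono_null (t := ⋃ n : ℕ, E ∩ Metric.ball 0 n) ?_ (measure_iUnion_null hball)
  rw [← Set.inter_iUnion, Metric.iUnion_ball_nat, Set.inter_univ]

theorem exists_conull_forall_dense_nsmul {P : Set ℕ} (hP : P.Infinite) :
    ∃ A : Set ℝ, MeasurableSet A ∧ volume Aᶜ = 0 ∧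
      ∀ x ∈ A, Dense ((fun p : ℕ => p • (x : UnitAddCircle)) '' P) := by
  let B := TopologicalSpace.countableBasis UnitAddCircle
  have hB : B.Countable := TopologicalSpace.countable_countableBasis _
  have hbasis := TopologicalSpace.isBasis_countableBasis UnitAddCircle
  refine ⟨⋂ V ∈ B, ⋃ p ∈ P, (fun x : ℝ => p • (x : UnitAddCircle)) ⁻¹' V, ?_, ?_, ?_⟩
  · exact MeasurableSet.biInter hB fun V hV => IsOpen.measurableSet <| isOpen_biUnion fun p _ =>
      (hbasis.isOpen hV).preimage (continuous_nsmul_coe p)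
  · simp only [Set.compl_iInter]
    refine (measure_biUnion_null_iff hB).2 fun V hV => ?_
    refine measure_mono_null ?_ (volume_forall_nsmul_notMem hP
      (hbasis.isOpen hV) (TopologicalSpace.nonempty_of_mem_countableBasis hV))
    intro x hx p hp hxV
    refine hx ?_
    exact Set.mem_biUnion hp hxV
  · intro x hx
    refine hbasis.dense_iff.2 fun V hV _ => ?_
    obtain ⟨p, hp, hpV⟩ := Set.mem_iUnion₂.1 (Set.mem_iInter₂.1 hx V hV)
    exact ⟨_, hpV, p, hp, rfl⟩

/-- If the Fourier coefficients of a Borel probability measure `ν` on the torus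
do not tend to `0`, then for Lebesgue-almost every `α` no good set represents `ν` at `α`. -/
theorem nonRajchman_not_representable_ae (ν : MeasureTheory.Measure UnitAddCircle)
    [MeasureTheory.IsProbabilityMeasure ν]
    (hν : 0 < Filter.limsup (fun p : ℕ => ‖∫ x, fourier (p : ℤ) x ∂ν‖) atTop) :
    ∃ A : Set ℝ, MeasurableSet A ∧ MeasureTheory.volume Aᶜ = 0 ∧
      ∀ α ∈ A, ¬ ∃ S : Set ℕ, IsGoodSet S ∧ IsLimitMeasure S α ν := by
  set c : ℕ → ℝ := fun p => ‖∫ x, fourier (p : ℤ) x ∂ν‖ with hc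
  obtain ⟨δ, hδ, hδlim⟩ := exists_between hν
  have hP : {p | δ < c p}.Infinite := Nat.frequently_atTop_iff_infinite.1 <|
    frequently_lt_of_lt_limsup (isBoundedUnder_of ⟨0, fun p => norm_nonneg _⟩ :
      IsBoundedUnder (· ≥ ·) atTop c).isCoboundedUnder_le hδlim
  obtain ⟨A, hAm, hA, hdense⟩ := exists_conull_forall_dense_nsmul hP
  refine ⟨A, hAm, hA, ?_⟩
  rintro α hα ⟨S, hS, hlim⟩
  refine hS.not_forall_dense_lt (hdense α hα) hδ ?_
  rintro _ ⟨p, hp, rfl⟩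
  simp only [complexEmpAvg_fourier_nsmul]
  exact (hlim.tendsto_complexEmpAvg (fourier (p : ℤ))).norm.eventually_const_lt hp
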